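/- arXiv:1804.01588 — 6 statements merged into one kernel-verified Lean document; each statement's English description precedes it below -/
import Mathlib

section
/- For every natural number d there exists a constant C > 0 (depending only on d) with the following property. Let (X, dist) be a finite metric space with n = |X| points and correlation dimension at most d. Then for every ε ∈ (0, 1), every real ℓ > 0, and every nonempty subset T ⊆ X, there exists an edge set E on T with |E| ≤ C · ε^{-d/2} · √n · |T| such that for all distinct x, y ∈ T with ℓ/8 ≤ dist(x, y) ≤ ℓ one has d_E(x, y) ≤ (1 + ε) · dist(x, y). -/
open scoped ENNReal BigOperators

universe u

/-- The distance function lifted to unordered pairs. -/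
noncomputable def sym2Dist {X : Type u} [MetricSpace X] : Sym2 X → ℝ :=
  Sym2.lift ⟨fun x y => dist x y, fun _ _ => dist_comm _ _⟩

/-- The weight of an edge set: the sum of the distances of its pairs. -/
noncomputable def edgeWeight {X : Type u} [MetricSpace X] (E : Finset (Sym2 X)) : ℝ :=
  ∑ e ∈ E, sym2Dist e

/-- `E` is an edge set on `T`: a finite set of unordered pairs of distinct points of `T`. -/
def IsEdgeSetOn {X : Type u} (T : Finset X) (E : Finset (Sym2 X)) : Prop :=
  ∀ e ∈ E, ¬ e.IsDiag ∧ ∀ x ∈ e, x ∈ T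

/-- The length of the path starting at `p` and visiting the points of the list in order. -/
noncomputable def pathLength {X : Type u} [MetricSpace X] : X → List X → ℝ
  | _, [] => 0
  | p, x :: xs => dist p x + pathLength x xs

/-- `p :: l` is a path from `p` to `q` all of whose consecutive pairs are edges of `E`. -/
def IsPathIn {X : Type u} (E : Finset (Sym2 X)) (p q : X) (l : List X) : Prop :=
  List.Chain (fun a b => s(a, b) ∈ E) p l ∧ (p :: l).getLast (List.cons_ne_nil p l) = q

/-- The path-distance in the edge set `E`: the infimum in `[0, ∞]` of lengths of paths
in `E` from `p` to `q`. -/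
noncomputable def pathDist {X : Type u} [MetricSpace X] (E : Finset (Sym2 X)) (p q : X) :
    ℝ≥0∞ :=
  ⨅ (l : List X) (_ : IsPathIn E p q l), ENNReal.ofReal (pathLength p l)

/-- The minimum weight of an edge set on `T` connecting all points of `T` (MST weight). -/
noncomputable def mstw {X : Type u} [MetricSpace X] (T : Finset X) : ℝ :=
  sInf {w : ℝ | ∃ E : Finset (Sym2 X), IsEdgeSetOn T E ∧
    (∀ x ∈ T, ∀ y ∈ T, pathDist E x y < ⊤) ∧ w = edgeWeight E}

/-- X has correlation dimension at most d. -/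
def HasCorrDimLE (X : Type u) [MetricSpace X] [Fintype X] (d : ℕ) : Prop :=
  ∀ ζ : ℝ, 0 < ζ → ∀ N : Finset X,
    (∀ y : X, ∃ p ∈ N, dist p y ≤ ζ) →
    (∀ p ∈ N, ∀ q ∈ N, p ≠ q → ζ < dist p q) →
    ∀ r : ℝ, 0 < r →
      ∑ x ∈ N, (N.filter fun y => dist x y ≤ 2 * r).card ≤
        2 ^ d * ∑ x ∈ N, (N.filter fun y => dist x y ≤ r).card

theorem aux_net {X : Type u} [MetricSpace X] [Fintype X] (ζ : ℝ) (hζ : 0 < ζ) (S A : Finset X)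
    (hAS : A ⊆ S) (hA : ∀ p ∈ A, ∀ q ∈ A, p ≠ q → ζ < dist p q) :
    ∃ N : Finset X, A ⊆ N ∧ N ⊆ S ∧ (∀ p ∈ N, ∀ q ∈ N, p ≠ q → ζ < dist p q) ∧
      ∀ y ∈ S, ∃ p ∈ N, dist p y ≤ ζ := by
  classical
  obtain ⟨N, hAN, hN⟩ := (Set.toFinite {N : Finset X | N ⊆ S ∧
    ∀ p ∈ N, ∀ q ∈ N, p ≠ q → ζ < dist p q}).exists_le_maximal (a := A) ⟨hAS, hA⟩
  refine ⟨N, hAN, hN.1.1, hN.1.2, ?_⟩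
  intro y hy
  by_contra! hc
  have hyN : y ∉ N := fun h => by
    have := hc y h
    rw [dist_self] at this
    linarith
  have h1 : insert y N ∈ {N : Finset X | N ⊆ S ∧
      ∀ p ∈ N, ∀ q ∈ N, p ≠ q → ζ < dist p q} := by
    refine ⟨Finset.insert_subset hy hN.1.1, ?_⟩
    intro p hp q hq hpq
    rw [Finset.mem_insert] at hp hq
    rcases hp with rfl | hp <;> rcases hq with rfl | hq
    · exact absurd rfl hpq
    · rw [dist_comm]; exact hc q hq
    · exact hc p hp
    · exact hN.1.2 p hp q hq hpq
  exact hyN (hN.2 h1 (Finset.subset_insert y N) (Finset.mem_insert_self y N))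

theorem aux_path_self {X : Type u} [MetricSpace X] (E : Finset (Sym2 X)) (y : X) :
    pathDist E y y ≤ ENNReal.ofReal 0 := by
  unfold pathDist
  refine iInf₂_le_of_le [] ?_ ?_
  · exact ⟨List.isChain_singleton _, rfl⟩
  · simp [pathLength]

theorem aux_path_cons {X : Type u} [MetricSpace X] (E : Finset (Sym2 X)) (x y z : X) (r : ℝ)
    (hr : 0 ≤ r) (h : x = y ∨ s(x, y) ∈ E) (hyz : pathDist E y z ≤ ENNReal.ofReal r) :
    pathDist E x z ≤ ENNReal.ofReal (dist x y + r) := by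
  rcases h with rfl | h
  · simpa using hyz
  · rw [ENNReal.ofReal_add dist_nonneg hr]
    refine le_trans ?_ (add_le_add_right hyz _)
    unfold pathDist
    rw [ENNReal.add_iInf]
    refine le_iInf fun l => ?_
    by_cases hl : IsPathIn E y z l
    · have hl' : IsPathIn E x z (y :: l) := by
        refine ⟨?_, ?_⟩
        · exact List.isChain_cons_cons.2 ⟨h, hl.1⟩
        · rw [List.getLast_cons (List.cons_ne_nil y l)]
          exact hl.2
      refine iInf₂_le_of_le (y :: l) hl' ?_
      simp only [hl, iInf_pos, pathLength]
      exact ENNReal.ofReal_add_le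
    · simp [hl]

theorem aux_iter {X : Type u} [MetricSpace X] [Fintype X] (d : ℕ) (h : HasCorrDimLE X d)
    (ζ : ℝ) (hζ : 0 < ζ) (N : Finset X) (h1 : ∀ y : X, ∃ p ∈ N, dist p y ≤ ζ)
    (h2 : ∀ p ∈ N, ∀ q ∈ N, p ≠ q → ζ < dist p q) (k : ℕ) :
    ∑ x ∈ N, (N.filter fun y => dist x y ≤ 2 ^ k * ζ).card ≤ (2 ^ k) ^ d * N.card := by
  induction k with
  | zero =>
    simp only [pow_zero, one_mul, one_pow]
    calc _ ≤ ∑ x ∈ N, 1 := by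
          refine Finset.sum_le_sum fun x hx => ?_
          rw [Finset.card_le_one]
          intro a ha b hb
          rw [Finset.mem_filter] at ha hb
          have e1 : x = a := by
            by_contra hne
            linarith [h2 x hx a ha.1 hne, ha.2]
          have e2 : x = b := by
            by_contra hne
            linarith [h2 x hx b hb.1 hne, hb.2]
          rw [← e1, ← e2]
      _ = N.card := by simp
  | succ k ih =>
    have := h ζ hζ N h1 h2 (2 ^ k * ζ) (by positivity)
    rw [← mul_assoc, ← pow_succ'] at this
    refine this.trans ((Nat.mul_le_mul_left _ ih).trans (le_of_eq ?_))
    rw [← mul_assoc, ← mul_pow, ← pow_succ']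

/-- Lemma 16: n-point metrics of correlation dimension at most d have (1+ε)-spanner
oracles with strong sparsity O(ε^{-d/2} √n). -/
theorem corr_dim_sparse_spanner_oracle (d : ℕ) :
    ∃ C : ℝ, 0 < C ∧
      ∀ (X : Type u) [MetricSpace X] [Fintype X], HasCorrDimLE X d →
        ∀ ε : ℝ, 0 < ε → ε < 1 → ∀ ℓ : ℝ, 0 < ℓ →
          ∀ T : Finset X, T.Nonempty →
            ∃ E : Finset (Sym2 X), IsEdgeSetOn T E ∧
              (E.card : ℝ) ≤ C * ε ^ (-(d : ℝ) / 2) * Real.sqrt (Fintype.card X) * T.card ∧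
              ∀ x ∈ T, ∀ y ∈ T, x ≠ y → ℓ / 8 ≤ dist x y → dist x y ≤ ℓ →
                pathDist E x y ≤ ENNReal.ofReal ((1 + ε) * dist x y) := by
  classical
  refine ⟨2 * 128 ^ d, by positivity, ?_⟩
  intro X _ _ hX ε hε hε1 ℓ hℓ T hT
  set ζ : ℝ := ε * ℓ / 32 with hζd
  have hζ : 0 < ζ := by positivity
  obtain ⟨N, -, hNT, hNs, hNc⟩ := aux_net ζ hζ T ∅ (by simp) (by simp)
  obtain ⟨N', hNN', -, hNs', hNc'⟩ := aux_net ζ hζ Finset.univ N (by simp) hNs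
  choose! f hfN hfd using hNc
  obtain ⟨k, hk1, hk2⟩ : ∃ k : ℕ, 64 / ε ≤ 2 ^ k ∧ (2 : ℝ) ^ k ≤ 128 / ε := by
    have h64 : 1 ≤ 64 / ε := by rw [le_div_iff₀ hε]; linarith
    obtain ⟨k, hk1, hk2⟩ := exists_nat_pow_near h64 (by norm_num : (1 : ℝ) < 2)
    refine ⟨k + 1, hk2.le, ?_⟩
    rw [pow_succ]
    have : 128 / ε = 64 / ε * 2 := by ring
    rw [this]
    linarith
  have hkζ : 2 * ℓ ≤ 2 ^ k * ζ := by
    calc 2 * ℓ = 64 / ε * ζ := by rw [hζd]; field_simp; norm_num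
      _ ≤ _ := by gcongr
  set M : Finset (X × X) := (N ×ˢ N).filter fun p => dist p.1 p.2 ≤ 2 * ℓ with hM
  set P : Finset (X × X) := T.image (fun a => (a, f a)) ∪ M with hP
  set E : Finset (Sym2 X) := (P.filter fun p => p.1 ≠ p.2).image (fun p => s(p.1, p.2)) with hE
  have hM1 : M.card ≤ T.card * T.card := by
    refine (Finset.card_filter_le _ _).trans ?_
    rw [Finset.card_product]
    exact Nat.mul_le_mul (Finset.card_le_card hNT) (Finset.card_le_card hNT)
  have hM2 : M.card ≤ (2 ^ k) ^ d * Fintype.card X := by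
    calc M.card ≤ ((N' ×ˢ N').filter fun p => dist p.1 p.2 ≤ 2 ^ k * ζ).card := by
          refine Finset.card_le_card ?_
          intro p hp
          simp only [hM, Finset.mem_filter, Finset.mem_product] at hp ⊢
          exact ⟨⟨hNN' hp.1.1, hNN' hp.1.2⟩, hp.2.trans hkζ⟩
      _ = ∑ x ∈ N', (N'.filter fun y => dist x y ≤ 2 ^ k * ζ).card := by
          simp only [Finset.card_filter, Finset.sum_product]
      _ ≤ (2 ^ k) ^ d * N'.card :=
          aux_iter d hX ζ hζ N' (fun y => hNc' y (Finset.mem_univ y)) hNs' k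
      _ ≤ _ := Nat.mul_le_mul_left _ (Finset.card_le_univ _)
  have hEc : E.card ≤ T.card + M.card :=
    (Finset.card_image_le.trans (Finset.card_filter_le _ _)).trans
      ((Finset.card_union_le _ _).trans (Nat.add_le_add_right Finset.card_image_le _))
  have hedge : ∀ a b : X, (a, b) ∈ P → a = b ∨ s(a, b) ∈ E := by
    intro a b hab
    by_cases hne : a = b
    · exact Or.inl hne
    · exact Or.inr (Finset.mem_image.2 ⟨(a, b), Finset.mem_filter.2 ⟨hab, hne⟩, rfl⟩)
  refine ⟨E, ?_, ?_, ?_⟩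
  · intro e he
    obtain ⟨⟨a, b⟩, hp, rfl⟩ := Finset.mem_image.1 he
    obtain ⟨hp, hne⟩ := Finset.mem_filter.1 hp
    have hab : a ∈ T ∧ b ∈ T := by
      rcases Finset.mem_union.1 hp with hp | hp
      · obtain ⟨c, hc, hce⟩ := Finset.mem_image.1 hp
        obtain ⟨rfl, rfl⟩ := Prod.mk.inj hce
        exact ⟨hc, hNT (hfN c hc)⟩
      · have := Finset.mem_product.1 (Finset.mem_filter.1 hp).1
        exact ⟨hNT this.1, hNT this.2⟩
    refine ⟨by simpa using hne, ?_⟩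
    intro x hx
    rcases Sym2.mem_iff.1 hx with rfl | rfl
    · exact hab.1
    · exact hab.2
  · have hne : Nonempty X := ⟨hT.choose⟩
    have hn : (1 : ℝ) ≤ Fintype.card X := by exact_mod_cast Fintype.card_pos
    have hs : 1 ≤ Real.sqrt (Fintype.card X) := Real.one_le_sqrt.2 hn
    set s := Real.sqrt (Fintype.card X) with hsd
    set g : ℝ := ε ^ (-(d : ℝ) / 2) with hg
    have hg1 : 1 ≤ g :=
      Real.one_le_rpow_of_pos_of_le_one_of_nonpos hε hε1.le (by
        have : (0 : ℝ) ≤ d := Nat.cast_nonneg d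
        linarith)
    have hgg : g * g = (1 / ε) ^ d := by
      rw [hg, ← Real.rpow_add hε, one_div, inv_pow, ← Real.rpow_natCast, ← Real.rpow_neg hε.le]
      congr 1
      ring
    have h128 : (1 : ℝ) ≤ 128 ^ d := one_le_pow₀ (by norm_num)
    have ht : (0 : ℝ) ≤ T.card := Nat.cast_nonneg _
    have hM1' : (M.card : ℝ) ≤ T.card * T.card := by exact_mod_cast hM1
    have hM2' : (M.card : ℝ) ≤ 128 ^ d * (g * g) * (s * s) := by
      rw [hgg, ← mul_pow, hsd, Real.mul_self_sqrt (by linarith)]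
      calc (M.card : ℝ) ≤ (2 ^ k) ^ d * Fintype.card X := by exact_mod_cast hM2
        _ ≤ (128 / ε) ^ d * Fintype.card X := by gcongr
        _ = _ := by ring
    have hM3 : (M.card : ℝ) ≤ 128 ^ d * g * s * T.card := by
      refine abs_le_of_sq_le_sq' ?_ (by positivity) |>.2
      calc (M.card : ℝ) ^ 2 = M.card * M.card := by ring
        _ ≤ (128 ^ d * (g * g) * (s * s)) * (T.card * T.card) := by gcongr
        _ ≤ 128 ^ d * ((128 ^ d * (g * g) * (s * s)) * (T.card * T.card)) :=
            le_mul_of_one_le_left (by positivity) h128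
        _ = _ := by ring
    have hT1 : (T.card : ℝ) ≤ 128 ^ d * g * s * T.card := by
      refine le_mul_of_one_le_left ht ?_
      exact one_le_mul_of_one_le_of_one_le (one_le_mul_of_one_le_of_one_le h128 hg1) hs
    have hEc' : (E.card : ℝ) ≤ T.card + M.card := by exact_mod_cast hEc
    linarith
  · intro x hx y hy hxy h1 h2
    have hζℓ : ζ ≤ ℓ / 32 := by
      rw [hζd]; nlinarith
    have hζε : 4 * ζ ≤ ε * dist x y := by
      rw [hζd]; nlinarith
    have a1 := hfd x hx
    have a2 := hfd y hy
    have a3 : dist (f x) (f y) ≤ dist (f x) x + dist x y + dist (f y) y := by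
      have := dist_triangle4 (f x) x y (f y)
      rwa [dist_comm y (f y)] at this
    have e1 := hedge x (f x) (Finset.mem_union_left _ (Finset.mem_image.2 ⟨x, hx, rfl⟩))
    have e2 := hedge (f x) (f y) (Finset.mem_union_right _ (Finset.mem_filter.2
      ⟨Finset.mem_product.2 ⟨hfN x hx, hfN y hy⟩, by
        show dist (f x) (f y) ≤ 2 * ℓ
        linarith⟩))
    have e3 := hedge y (f y) (Finset.mem_union_left _ (Finset.mem_image.2 ⟨y, hy, rfl⟩))
    have e3' : f y = y ∨ s(f y, y) ∈ E := by
      rcases e3 with e | e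
      · exact Or.inl e.symm
      · right; rwa [Sym2.eq_swap]
    have p3 := aux_path_cons E (f y) y y 0 le_rfl e3' (aux_path_self E y)
    have p2 := aux_path_cons E (f x) (f y) y _ (by positivity) e2 p3
    have p1 := aux_path_cons E x (f x) y _ (by positivity) e1 p2
    refine p1.trans (ENNReal.ofReal_le_ofReal ?_)
    rw [dist_comm x (f x)]
    linarith
end

section
/- Let (X, dist) be a metric space, let p ∈ X, let ε ∈ (0, 1), and let y_0, y_1, …, y_I (I ≥ 0) be points of X such that: (i) for all 0 ≤ a ≤ b ≤ I, dist(y_a, y_b) = Σ_{i=a+1}^{b} dist(y_{i−1}, y_i) (the points lie in order along a shortest path); (ii) R := dist(p, y_0) satisfies R > 0 and dist(p, y_i) ≥ R for every 0 ≤ i ≤ I; (iii) for every 1 ≤ i ≤ I, (1 + ε) · dist(p, y_i) < dist(p, y_{i−1}) + dist(y_{i−1}, y_i). Then dist(y_0, y_I) ≤ 4 · ε⁻¹ · R. -/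
open scoped BigOperators

universe u

/-- Property (4) of Lemma 7: the distance along the shortest path between the first and
last greedily selected points is at most 4ε⁻¹R. -/
theorem single_source_spanner_span_bound {X : Type u} [MetricSpace X]
    (p : X) (ε : ℝ) (hε0 : 0 < ε) (hε1 : ε < 1) (I : ℕ) (y : ℕ → X)
    (horder : ∀ a b : ℕ, a ≤ b → b ≤ I →
      dist (y a) (y b) = ∑ i ∈ Finset.Ioc a b, dist (y (i - 1)) (y i))
    (hR0 : 0 < dist p (y 0))
    (hRmin : ∀ i ≤ I, dist p (y 0) ≤ dist p (y i))
    (hgreedy : ∀ i, 1 ≤ i → i ≤ I →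
      (1 + ε) * dist p (y i) < dist p (y (i - 1)) + dist (y (i - 1)) (y i)) :
    dist (y 0) (y I) ≤ 4 * ε⁻¹ * dist p (y 0) := by
  rcases I with _ | n
  · have : 0 < ε⁻¹ := inv_pos.mpr hε0
    rw [dist_self]
    positivity
  · have h1 := horder 0 (n + 1) (by omega) le_rfl
    have h2 := horder 0 n (by omega) (by omega)
    rw [Finset.sum_Ioc_succ_top (by omega), ← h2] at h1
    have h3 := hgreedy (n + 1) (by omega) le_rfl
    simp only [Nat.add_sub_cancel] at h1 h3
    have h4 := dist_triangle p (y 0) (y n)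
    have h5 := dist_triangle (y 0) p (y (n + 1))
    rw [dist_comm (y 0) p] at h5
    have h6 : ε * dist p (y (n + 1)) ≤ 2 * dist p (y 0) := by linarith
    have h7 : ε * dist (y 0) (y (n + 1)) ≤ 4 * dist p (y 0) := by nlinarith
    have h8 : 4 * ε⁻¹ * dist p (y 0) = (4 * dist p (y 0)) / ε := by
      field_simp
    rw [h8, le_div_iff₀ hε0]
    linarith
end

section
/- Let (X, dist) be a metric space, let p ∈ X, let ε ∈ (0, 1), and let y_0, y_1, …, y_I (I ≥ 0) be points of X such that: (i) for all 0 ≤ a ≤ b ≤ I, dist(y_a, y_b) = Σ_{i=a+1}^{b} dist(y_{i−1}, y_i) (the points lie in order along a shortest path); (ii) R := dist(p, y_0) satisfies R > 0 and dist(p, y_i) ≥ R for every 0 ≤ i ≤ I; (iii) for every 1 ≤ i ≤ I, (1 + ε) · dist(p, y_i) < dist(p, y_{i−1}) + dist(y_{i−1}, y_i). Then I ≤ 8 · ε⁻². -/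
open scoped BigOperators

universe u

/-- Property (3) of Lemma 7: at most 8ε⁻² points are selected on each side. -/
theorem single_source_spanner_count_bound {X : Type u} [MetricSpace X]
    (p : X) (ε : ℝ) (hε0 : 0 < ε) (hε1 : ε < 1) (I : ℕ) (y : ℕ → X)
    (horder : ∀ a b : ℕ, a ≤ b → b ≤ I →
      dist (y a) (y b) = ∑ i ∈ Finset.Ioc a b, dist (y (i - 1)) (y i))
    (hR0 : 0 < dist p (y 0))
    (hRmin : ∀ i ≤ I, dist p (y 0) ≤ dist p (y i))
    (hgreedy : ∀ i, 1 ≤ i → i ≤ I →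
      (1 + ε) * dist p (y i) < dist p (y (i - 1)) + dist (y (i - 1)) (y i)) :
    (I : ℝ) ≤ 8 * ε⁻¹ ^ 2 := by
  have key : ∀ k : ℕ, k ≤ I →
      ε * k * dist p (y 0) ≤ dist (y 0) (y k) - dist p (y k) + dist p (y 0) := by
    intro k
    induction k with
    | zero => intro _; simp
    | succ k ih =>
      intro hk
      have h1 := ih (by omega)
      have h2 := hgreedy (k + 1) (by omega) hk
      have h3 := hRmin (k + 1) hk
      have h4 := horder 0 (k + 1) (by omega) hk
      have h5 := horder 0 k (by omega) (by omega)
      rw [Finset.sum_Ioc_succ_top (by omega), ← h5] at h4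
      simp only [Nat.add_sub_cancel] at h2 h4
      have h6 := mul_le_mul_of_nonneg_left h3 hε0.le
      push_cast
      linarith
  have h1 := key I le_rfl
  have h2 := dist_triangle (y 0) p (y I)
  rw [dist_comm (y 0) p] at h2
  have h3 : ε * I ≤ 2 := by
    by_contra! h
    nlinarith [mul_lt_mul_of_pos_right h hR0]
  rw [inv_pow, ← div_eq_mul_inv, le_div_iff₀ (by positivity)]
  nlinarith
end

section
/- Let (X, dist) be a metric space, let p ∈ X, let ε ∈ (0, 1), and let y_0, y_1, …, y_I (I ≥ 0) be points of X such that: (i) for all 0 ≤ a ≤ b ≤ I, dist(y_a, y_b) = Σ_{i=a+1}^{b} dist(y_{i−1}, y_i) (the points lie in order along a shortest path); (ii) R := dist(p, y_0) satisfies R > 0 and dist(p, y_i) ≥ R for every 0 ≤ i ≤ I; (iii) for every 1 ≤ i ≤ I, (1 + ε) · dist(p, y_i) < dist(p, y_{i−1}) + dist(y_{i−1}, y_i). Then Σ_{i=0}^{I} dist(p, y_i) ≤ 8 · ε⁻² · R. -/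
open scoped BigOperators

universe u

/-- Property (2) of Lemma 7: the total weight of the selected source-to-path shortest
paths is at most 8ε⁻²R. -/
theorem single_source_spanner_weight_bound {X : Type u} [MetricSpace X]
    (p : X) (ε : ℝ) (hε0 : 0 < ε) (hε1 : ε < 1) (I : ℕ) (y : ℕ → X)
    (horder : ∀ a b : ℕ, a ≤ b → b ≤ I →
      dist (y a) (y b) = ∑ i ∈ Finset.Ioc a b, dist (y (i - 1)) (y i))
    (hR0 : 0 < dist p (y 0))
    (hRmin : ∀ i ≤ I, dist p (y 0) ≤ dist p (y i))
    (hgreedy : ∀ i, 1 ≤ i → i ≤ I →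
      (1 + ε) * dist p (y i) < dist p (y (i - 1)) + dist (y (i - 1)) (y i)) :
    ∑ i ∈ Finset.range (I + 1), dist p (y i) ≤ 8 * ε⁻¹ ^ 2 * dist p (y 0) := by
  have key : ∀ n, n ≤ I → ε * ∑ i ∈ Finset.range (n + 1), dist p (y i) ≤
      ε * dist p (y 0) + dist p (y 0) - dist p (y n) + dist (y 0) (y n) := by
    intro n
    induction n with
    | zero => intro _; simp
    | succ n ih =>
      intro hn
      have h1 := ih (by omega)
      have h2 := hgreedy (n + 1) (by omega) hn
      have h3 := horder 0 (n + 1) (by omega) hn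
      rw [Finset.sum_Ioc_succ_top (by omega), ← horder 0 n (by omega) (by omega)] at h3
      rw [Finset.sum_range_succ, mul_add]
      simp only [Nat.add_sub_cancel] at h2 h3
      linarith
  have h := key I le_rfl
  have ht := dist_triangle_left (y 0) (y I) p
  set S := ∑ i ∈ Finset.range (I + 1), dist p (y i)
  set R := dist p (y 0)
  have h1 : ε * S ≤ 3 * R := by nlinarith
  have h2 : S * ε ^ 2 ≤ 8 * R := by nlinarith
  have h3 : 8 * ε⁻¹ ^ 2 * R = 8 * R / ε ^ 2 := by field_simp
  rw [h3, le_div_iff₀ (by positivity)]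
  exact h2
end

section
/- Let (X, dist) be a metric space, let T ⊆ X be a finite set, let ε ∈ (0, 1), and let ℓ > 0. Call an edge set F on T admissible if d_F(x, y) ≤ (1 + ε) · dist(x, y) for all distinct x, y ∈ T with ℓ/8 ≤ dist(x, y) ≤ ℓ. Suppose E is an admissible edge set on T that is minimal with respect to inclusion (no proper subset of E is admissible). Then every edge {x, y} ∈ E satisfies dist(x, y) ≤ 2ℓ, and consequently w(E) ≤ 2ℓ · |E|. -/
open scoped ENNReal BigOperators

universe u

/-- F is admissible: it (1+ε)-preserves all terminal distances lying in [ℓ/8, ℓ]. -/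
def AdmissibleFor {X : Type u} [MetricSpace X] (T : Finset X) (ε ℓ : ℝ)
    (F : Finset (Sym2 X)) : Prop :=
  ∀ x ∈ T, ∀ y ∈ T, x ≠ y → ℓ / 8 ≤ dist x y → dist x y ≤ ℓ →
    pathDist F x y ≤ ENNReal.ofReal ((1 + ε) * dist x y)

theorem pathLength_nonneg_aux {X : Type u} [MetricSpace X] (l : List X) :
    ∀ p : X, 0 ≤ pathLength p l := by
  induction l with
  | nil => intro p; simp [pathLength]
  | cons a l ih =>
    intro p
    have := ih a
    simp only [pathLength]
    positivity

theorem chain_erase_or_long_aux {X : Type u} [MetricSpace X] [DecidableEq (Sym2 X)]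
    (E : Finset (Sym2 X)) (e : Sym2 X) (l : List X) :
    ∀ p : X, List.IsChain (fun a b => s(a, b) ∈ E) (p :: l) →
      List.IsChain (fun a b => s(a, b) ∈ E.erase e) (p :: l) ∨ sym2Dist e ≤ pathLength p l := by
  induction l with
  | nil => intro p _; left; simp
  | cons a l ih =>
    intro p h
    rw [List.isChain_cons_cons] at h
    simp only [pathLength]
    by_cases he : s(p, a) = e
    · right
      subst he
      have := pathLength_nonneg_aux l a
      have h2 : sym2Dist s(p, a) = dist p a := rfl
      linarith
    · rcases ih a h.2 with h1 | h1
      · left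
        rw [List.isChain_cons_cons]
        exact ⟨Finset.mem_erase.2 ⟨he, h.1⟩, h1⟩
      · right
        have : 0 ≤ dist p a := dist_nonneg
        linarith

/-- Every edge of a minimal admissible edge set has length at most 2ℓ, hence its weight
is at most 2ℓ·|E|. -/
theorem minimal_admissible_edge_length_bound {X : Type u} [MetricSpace X]
    (T : Finset X) (ε ℓ : ℝ) (hε0 : 0 < ε) (hε1 : ε < 1) (hℓ : 0 < ℓ)
    (E : Finset (Sym2 X)) (hE : IsEdgeSetOn T E)
    (hadm : AdmissibleFor T ε ℓ E)
    (hmin : ∀ F : Finset (Sym2 X), F ⊂ E → ¬ AdmissibleFor T ε ℓ F) :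
    (∀ e ∈ E, sym2Dist e ≤ 2 * ℓ) ∧ edgeWeight E ≤ 2 * ℓ * E.card := by
  classical
  have key : ∀ e ∈ E, sym2Dist e ≤ 2 * ℓ := by
    intro e he
    by_contra! hlong
    refine hmin (E.erase e) (Finset.erase_ssubset he) ?_
    intro x hx y hy hxy h8 hle
    by_contra! hlt
    have h1 := hadm x hx y hy hxy h8 hle
    have h2 : min (ENNReal.ofReal (2 * ℓ)) (pathDist (E.erase e) x y) ≤ pathDist E x y := by
      refine le_iInf₂ fun l hl => ?_
      rcases chain_erase_or_long_aux E e l x hl.1 with h | h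
      · exact (min_le_right _ _).trans (iInf₂_le l ⟨h, hl.2⟩)
      · exact (min_le_left _ _).trans (ENNReal.ofReal_le_ofReal (hlong.le.trans h))
    have h3 : ENNReal.ofReal ((1 + ε) * dist x y) < ENNReal.ofReal (2 * ℓ) := by
      rw [ENNReal.ofReal_lt_ofReal_iff (by positivity)]
      nlinarith
    exact absurd (h2.trans h1) (not_le.2 (lt_min h3 hlt))
  refine ⟨key, ?_⟩
  have := Finset.sum_le_card_nsmul E sym2Dist (2 * ℓ) key
  rw [nsmul_eq_mul, mul_comm] at this
  exact this
end

section
/- There is an absolute constant C > 0 with the following property. Let G be a finite edge-weighted graph with positive edge weights, let ε ∈ (0, 1) and ℓ > 0. Let P be a shortest path in G, and let Q_1, Q_2, …, Q_r be shortest paths in G such that for every 1 ≤ i ≤ r, Q_i shares at least one vertex with P and w(Q_i) ≤ ℓ. Let s_i and t_i denote the endpoints of Q_i, and let k be the number of distinct points in {s_1, t_1, …, s_r, t_r}. Then there exists a subset F ⊆ E(G) with w(F) ≤ C · k · ε⁻² · ℓ such that d_F(s_i, t_i) ≤ (1 + ε) · d_G(s_i, t_i) for every 1 ≤ i ≤ r.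 -/
open scoped ENNReal BigOperators

universe u

/-- A finite edge-weighted graph on vertex type `V`: an edge set of unordered pairs of
distinct vertices together with a positive weight on each edge. -/
structure WGraph (V : Type u) where
  edges : Finset (Sym2 V)
  loopless : ∀ e ∈ edges, ¬ e.IsDiag
  w : Sym2 V → ℝ
  w_pos : ∀ e ∈ edges, 0 < w e

/-- The length of the walk starting at `p` and visiting the points of the list in order,
with respect to the edge weight `w`. -/
noncomputable def walkLen {V : Type u} (w : Sym2 V → ℝ) : V → List V → ℝ
  | _, [] => 0
  | p, x :: xs => w s(p, x) + walkLen w x xs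

/-- `p :: l` is a walk from `p` to `q` all of whose steps are edges of `F`. -/
def IsWalkIn {V : Type u} (F : Finset (Sym2 V)) (p q : V) (l : List V) : Prop :=
  List.Chain (fun a b => s(a, b) ∈ F) p l ∧ (p :: l).getLast (List.cons_ne_nil p l) = q

/-- The distance from `p` to `q` using only edges of `F`: the infimum in `[0, ∞]` of
lengths of walks in `F` from `p` to `q`. -/
noncomputable def distIn {V : Type u} (G : WGraph V) (F : Finset (Sym2 V)) (p q : V) :
    ℝ≥0∞ :=
  ⨅ (l : List V) (_ : IsWalkIn F p q l), ENNReal.ofReal (walkLen G.w p l)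

/-- The graph distance `d_G`. -/
noncomputable def gdist {V : Type u} (G : WGraph V) (p q : V) : ℝ≥0∞ :=
  distIn G G.edges p q

/-- `p :: l` is a shortest path in `G` from `p` to `q`: a walk with no repeated vertex
whose length equals the graph distance between its endpoints. -/
def IsShortestPath {V : Type u} (G : WGraph V) (p q : V) (l : List V) : Prop :=
  IsWalkIn G.edges p q l ∧ (p :: l).Nodup ∧
    ENNReal.ofReal (walkLen G.w p l) = gdist G p q

/-- The total weight of a set of edges. -/
noncomputable def setWeight {V : Type u} (G : WGraph V) (F : Finset (Sym2 V)) : ℝ :=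
  ∑ e ∈ F, G.w e

/-- The set of edges of the walk `p :: l`. -/
def edgesOfWalk {V : Type u} [DecidableEq V] : V → List V → Finset (Sym2 V)
  | _, [] => ∅
  | p, x :: xs => insert s(p, x) (edgesOfWalk x xs)

/-- Walks from `p` to `q` in `F` of total length exactly `L`. -/
inductive Wk {V : Type u} (F : Finset (Sym2 V)) (w : Sym2 V → ℝ) : V → V → ℝ → Prop
  | nil (p : V) : Wk F w p p 0
  | cons {p x q : V} {L : ℝ} (h : s(p, x) ∈ F) (t : Wk F w x q L) : Wk F w p q (w s(p, x) + L)

theorem Wk.trans {V : Type u} {F : Finset (Sym2 V)} {w : Sym2 V → ℝ} {p q r : V} {a b : ℝ}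
    (h : Wk F w p q a) (h' : Wk F w q r b) : Wk F w p r (a + b) := by
  induction h with
  | nil p => simpa using h'
  | cons h t ih => rw [add_assoc]; exact Wk.cons h (ih h')

theorem Wk.single {V : Type u} {F : Finset (Sym2 V)} {w : Sym2 V → ℝ} {p q : V}
    (h : s(p, q) ∈ F) : Wk F w p q (w s(p, q)) := by
  simpa using Wk.cons (w := w) h (Wk.nil q)

theorem Wk.symm {V : Type u} {F : Finset (Sym2 V)} {w : Sym2 V → ℝ} {p q : V} {a : ℝ}
    (h : Wk F w p q a) : Wk F w q p a := by
  induction h with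
  | nil p => exact Wk.nil p
  | @cons p x q L h t ih =>
    have h1 : Wk F w x p (w s(x, p)) := Wk.single (by rwa [Sym2.eq_swap])
    have := ih.trans h1
    rw [add_comm, Sym2.eq_swap] at this
    exact this

theorem Wk.mono {V : Type u} {F F' : Finset (Sym2 V)} {w : Sym2 V → ℝ} {p q : V} {a : ℝ}
    (hF : F ⊆ F') (h : Wk F w p q a) : Wk F' w p q a := by
  induction h with
  | nil p => exact Wk.nil p
  | cons h t ih => exact Wk.cons (hF h) ih

theorem Wk.nonneg {V : Type u} {G : WGraph V} {p q : V} {a : ℝ}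
    (h : Wk G.edges G.w p q a) : 0 ≤ a := by
  induction h with
  | nil p => exact le_rfl
  | cons h t ih => have := G.w_pos _ h; linarith

theorem setWeight_union_le {V : Type u} [DecidableEq V] (G : WGraph V) (A B : Finset (Sym2 V))
    (hA : A ⊆ G.edges) : setWeight G (A ∪ B) ≤ setWeight G A + setWeight G B := by
  unfold setWeight
  rw [← Finset.sum_union_inter]
  have : 0 ≤ ∑ e ∈ A ∩ B, G.w e :=
    Finset.sum_nonneg fun e he => (G.w_pos e (hA (Finset.mem_inter.1 he).1)).le
  linarith

theorem setWeight_biUnion_le {V : Type u} [DecidableEq V] {ι : Type*} [DecidableEq ι]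
    (G : WGraph V) (T : Finset ι)
    (E : ι → Finset (Sym2 V)) (c : ℝ) (hE : ∀ i ∈ T, E i ⊆ G.edges)
    (hc : ∀ i ∈ T, setWeight G (E i) ≤ c) :
    setWeight G (T.biUnion E) ≤ T.card * c := by
  induction T using Finset.induction_on with
  | empty => simp [setWeight]
  | insert a T ha ih =>
    rw [Finset.biUnion_insert, Finset.card_insert_of_notMem ha]
    have h1 := setWeight_union_le G (E a) (T.biUnion E) (hE a (by simp))
    have h2 := ih (fun i hi => hE i (by simp [hi])) (fun i hi => hc i (by simp [hi]))
    have h3 := hc a (by simp)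
    push_cast
    linarith

theorem Wk.light {V : Type u} [DecidableEq V] {G : WGraph V} {p q : V} {a : ℝ}
    (h : Wk G.edges G.w p q a) :
    ∃ E ⊆ G.edges, setWeight G E ≤ a ∧ Wk E G.w p q a := by
  induction h with
  | nil p => exact ⟨∅, by simp, by simp [setWeight], Wk.nil p⟩
  | @cons p x q L h t ih =>
    obtain ⟨E, hE, hw, hW⟩ := ih
    refine ⟨{s(p, x)} ∪ E, ?_, ?_, ?_⟩
    · exact Finset.union_subset (by simpa using h) hE
    · have := setWeight_union_le G {s(p, x)} E (by simpa using h)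
      have h2 : setWeight G {s(p, x)} = G.w s(p, x) := by simp [setWeight]
      linarith
    · exact Wk.cons (by simp) (hW.mono Finset.subset_union_right)

theorem Wk.toList {V : Type u} {F : Finset (Sym2 V)} {w : Sym2 V → ℝ} {p q : V} {a : ℝ}
    (h : Wk F w p q a) : ∃ l, IsWalkIn F p q l ∧ walkLen w p l = a := by
  induction h with
  | nil p => exact ⟨[], ⟨List.IsChain.singleton _, by simp⟩, rfl⟩
  | @cons p x q L h t ih =>
    obtain ⟨l, ⟨h1, h2⟩, h3⟩ := ih
    refine ⟨x :: l, ⟨?_, ?_⟩, ?_⟩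
    · exact List.IsChain.cons_cons h h1
    · rw [List.getLast_cons (by simp)]; exact h2
    · simp [walkLen, h3]

theorem IsWalkIn.tail {V : Type u} {F : Finset (Sym2 V)} {p x q : V} {l : List V}
    (h : IsWalkIn F p q (x :: l)) : s(p, x) ∈ F ∧ IsWalkIn F x q l := by
  obtain ⟨h1, h2⟩ := h
  rw [List.getLast_cons (by simp)] at h2
  cases h1 with
  | cons_cons a b => exact ⟨a, b, h2⟩

theorem wk_of_list {V : Type u} {F : Finset (Sym2 V)} {w : Sym2 V → ℝ} {q : V} {l : List V} :
    ∀ {p : V}, IsWalkIn F p q l → Wk F w p q (walkLen w p l) := by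
  induction l with
  | nil => intro p h; obtain ⟨_, h⟩ := h; simp at h; subst h; exact Wk.nil _
  | cons x l ih =>
    intro p h
    exact Wk.cons h.tail.1 (ih h.tail.2)

theorem wk_split {V : Type u} {F : Finset (Sym2 V)} {w : Sym2 V → ℝ} {q v : V} {l : List V} :
    ∀ {p : V}, IsWalkIn F p q l → v ∈ p :: l →
      ∃ a b, a + b = walkLen w p l ∧ Wk F w p v a ∧ Wk F w v q b := by
  induction l with
  | nil =>
    intro p h hv
    simp at hv; subst hv
    exact ⟨0, 0, by simp [walkLen], Wk.nil _, wk_of_list h⟩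
  | cons x l ih =>
    intro p h hv
    rcases List.mem_cons.1 hv with rfl | hv
    · exact ⟨0, _, zero_add _, Wk.nil _, wk_of_list h⟩
    · obtain ⟨a, b, hab, ha, hb⟩ := ih h.tail.2 hv
      exact ⟨_, b, by simp [walkLen, ← hab, add_assoc], Wk.cons h.tail.1 ha, hb⟩

theorem wk_index {V : Type u} {F : Finset (Sym2 V)} {w : Sym2 V → ℝ} {q : V} {l : List V} :
    ∀ {p : V}, IsWalkIn F p q l → ∃ (n : ℕ) (f : ℕ → V), f 0 = p ∧ f n = q ∧
      (∀ i < n, s(f i, f (i + 1)) ∈ F) ∧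
      ∑ i ∈ Finset.range n, w s(f i, f (i + 1)) = walkLen w p l ∧
      ∀ v ∈ p :: l, ∃ i ≤ n, f i = v := by
  induction l with
  | nil =>
    intro p h
    obtain ⟨_, h⟩ := h; simp at h; subst h
    exact ⟨0, fun _ => p, rfl, rfl, by simp, by simp [walkLen], by simp⟩
  | cons x l ih =>
    intro p h
    obtain ⟨n, f, h0, hn, he, hs, hv⟩ := ih h.tail.2
    refine ⟨n + 1, fun i => Nat.casesOn i p f, rfl, hn, ?_, ?_, ?_⟩
    · intro i hi
      cases i with
      | zero => simpa [h0] using h.tail.1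
      | succ i => exact he i (by omega)
    · rw [Finset.sum_range_succ']
      simp only [walkLen, ← hs, h0]
      exact add_comm _ _
    · intro v hv'
      rcases List.mem_cons.1 hv' with rfl | hv'
      · exact ⟨0, by omega, rfl⟩
      · obtain ⟨i, hi, hfi⟩ := hv v hv'
        exact ⟨i + 1, by omega, hfi⟩

theorem shortest_le {V : Type u} {G : WGraph V} {p q : V} {l : List V}
    (h : IsShortestPath G p q l) {L : ℝ} (hL : Wk G.edges G.w p q L) : walkLen G.w p l ≤ L := by
  obtain ⟨l', h1, h2⟩ := hL.toList
  have h3 : gdist G p q ≤ ENNReal.ofReal L := by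
    rw [← h2]; exact iInf₂_le l' h1
  rw [← h.2.2] at h3
  exact (ENNReal.ofReal_le_ofReal_iff hL.nonneg).1 h3

theorem portals (S : Finset ℕ) (hS : S.Nonempty) (D pos : ℕ → ℝ) (ε : ℝ) (h0 : 0 < ε)
    (h1 : ε < 1) (hD : ∀ i ∈ S, 0 ≤ D i)
    (hlip : ∀ i ∈ S, ∀ j ∈ S, D i ≤ D j + |pos i - pos j|)
    (htri : ∀ i ∈ S, ∀ j ∈ S, |pos i - pos j| ≤ D i + D j) :
    ∃ T ⊆ S, (T.card : ℝ) ≤ 16 * ε⁻¹ ^ 2 ∧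
      ∀ i ∈ S, ∃ q ∈ T, D q + |pos q - pos i| ≤ (1 + ε) * D i := by
  classical
  obtain ⟨i0, hi0, hmin⟩ := S.exists_min_image D hS
  set δ := D i0 with hδ
  set N := S.filter (fun i => |pos i - pos i0| < 3 * δ / ε) with hN
  let g : ℕ → ℤ := fun i => ⌊(pos i - pos i0) / (ε * δ / 2)⌋
  have hch : ∀ z ∈ N.image g, ∃ i ∈ N, g i = z := fun z hz => Finset.mem_image.1 hz
  choose! c hcN hcg using hch
  have hinv : 1 ≤ ε⁻¹ ^ 2 := by
    have : 1 ≤ ε⁻¹ := (one_le_inv₀ h0).2 h1.le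
    nlinarith
  have hNpos : ∀ i ∈ N, 0 < δ := by
    intro i hi
    have h := (Finset.mem_filter.1 hi).2
    have h2 := (abs_nonneg _).trans_lt h
    by_contra hc
    have := div_nonpos_of_nonpos_of_nonneg (show 3 * δ ≤ 0 by linarith) h0.le
    linarith
  refine ⟨insert i0 ((N.image g).image c), ?_, ?_, ?_⟩
  · intro x hx
    rcases Finset.mem_insert.1 hx with rfl | hx
    · exact hi0
    · obtain ⟨z, hz, rfl⟩ := Finset.mem_image.1 hx
      exact (Finset.mem_filter.1 (hcN z hz)).1
  · set m := ⌈6 * ε⁻¹ ^ 2⌉₊ with hm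
    have hsub : N.image g ⊆ Finset.Icc (-(m : ℤ)) m := by
      intro z hz
      obtain ⟨i, hi, rfl⟩ := Finset.mem_image.1 hz
      have hd := hNpos i hi
      have h := (Finset.mem_filter.1 hi).2
      have hb : |(pos i - pos i0) / (ε * δ / 2)| < 6 * ε⁻¹ ^ 2 := by
        have hp : 0 < ε * δ / 2 := by positivity
        rw [abs_div, abs_of_pos hp, div_lt_iff₀ hp]
        calc _ < 3 * δ / ε := h
          _ = _ := by field_simp; ring
      have hmle : 6 * ε⁻¹ ^ 2 ≤ m := Nat.le_ceil _
      rw [abs_lt] at hb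
      rw [Finset.mem_Icc]
      constructor
      · apply Int.le_floor.2
        push_cast
        linarith [hb.1]
      · have : g i ≤ (m : ℤ) := by
          have h5 := Int.floor_le ((pos i - pos i0) / (ε * δ / 2))
          have : ((g i : ℤ) : ℝ) ≤ ((m : ℤ) : ℝ) := by
            push_cast
            simp only [g]
            linarith [hb.2]
          exact_mod_cast this
        exact this
    have hc1 := (Finset.card_insert_le i0 ((N.image g).image c))
    have hc2 : ((N.image g).image c).card ≤ (N.image g).card := Finset.card_image_le
    have hc3 := Finset.card_le_card hsub
    rw [Int.card_Icc] at hc3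
    have hc4 : (insert i0 ((N.image g).image c)).card ≤ 2 * m + 2 := by omega
    have hc5 : ((insert i0 ((N.image g).image c)).card : ℝ) ≤ 2 * m + 2 := by exact_mod_cast hc4
    have hm2 : (m : ℝ) < 6 * ε⁻¹ ^ 2 + 1 := Nat.ceil_lt_add_one (by positivity)
    linarith
  · intro i hi
    by_cases hiN : i ∈ N
    · have hz : g i ∈ N.image g := Finset.mem_image_of_mem g hiN
      refine ⟨c (g i), by simp only [Finset.mem_insert]; right; exact Finset.mem_image_of_mem c hz, ?_⟩
      have hd := hNpos i hiN
      have hp : 0 < ε * δ / 2 := by positivity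
      have hab := Int.abs_sub_lt_one_of_floor_eq_floor (hcg _ hz)
      rw [← sub_div, abs_div, abs_of_pos hp, div_lt_one hp] at hab
      have e : pos (c (g i)) - pos i0 - (pos i - pos i0) = pos (c (g i)) - pos i := by ring
      rw [e] at hab
      have hl := hlip (c (g i)) (Finset.mem_filter.1 (hcN _ hz)).1 i hi
      have := hmin i hi
      nlinarith
    · refine ⟨i0, by simp, ?_⟩
      have hfar : 3 * δ / ε ≤ |pos i - pos i0| := by
        by_contra hc
        exact hiN (Finset.mem_filter.2 ⟨hi, not_le.1 hc⟩)
      rw [div_le_iff₀ h0] at hfar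
      have ht := htri i hi i0 hi0
      have hd := hD i0 hi0
      rw [abs_sub_comm]
      nlinarith

theorem terminal_spanner {V : Type u} [DecidableEq V] (G : WGraph V) (ε ℓ : ℝ) (h0 : 0 < ε)
    (h1 : ε < 1) (hl : 0 < ℓ) (n : ℕ) (f : ℕ → V)
    (he : ∀ i < n, s(f i, f (i + 1)) ∈ G.edges)
    (hsh : ∀ L, Wk G.edges G.w (f 0) (f n) L →
      ∑ i ∈ Finset.range n, G.w s(f i, f (i + 1)) ≤ L)
    (u : V) (S : Finset ℕ) (hSn : ∀ i ∈ S, i ≤ n) (D : ℕ → ℝ)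
    (hW : ∀ i ∈ S, Wk G.edges G.w u (f i) (D i)) (hDl : ∀ i ∈ S, D i ≤ ℓ)
    (hmin : ∀ i ∈ S, ∀ L, Wk G.edges G.w u (f i) L → D i ≤ L) :
    ∃ F ⊆ G.edges, setWeight G F ≤ 18 * ε⁻¹ ^ 2 * ℓ ∧
      ∀ i ∈ S, ∃ L ≤ (1 + ε) * D i, Wk F G.w u (f i) L := by
  rcases S.eq_empty_or_nonempty with rfl | hS
  · exact ⟨∅, by simp, by simp only [setWeight, Finset.sum_empty]; positivity, by simp⟩
  let pos : ℕ → ℝ := fun i => ∑ j ∈ Finset.range i, G.w s(f j, f (j + 1))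
  let seg : ℕ → ℕ → Finset (Sym2 V) := fun a b =>
    (Finset.Ico a b).image (fun j => s(f j, f (j + 1)))
  have hseg : ∀ a b i j, a ≤ i → i ≤ j → j ≤ b →
      Wk (seg a b) G.w (f i) (f j) (pos j - pos i) := by
    intro a b i j hai hij
    induction j, hij using Nat.le_induction with
    | base => intro _; simpa using Wk.nil (F := seg a b) (w := G.w) (f i)
    | succ j hij ih =>
      intro hjb
      have h2 : Wk (seg a b) G.w (f j) (f (j + 1)) (G.w s(f j, f (j + 1))) :=
        Wk.single (Finset.mem_image_of_mem (fun j => s(f j, f (j + 1)))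
          (Finset.mem_Ico.2 ⟨by omega, by omega⟩))
      have h3 := (ih (by omega)).trans h2
      have e : pos (j + 1) - pos i = pos j - pos i + G.w s(f j, f (j + 1)) := by
        simp only [pos, Finset.sum_range_succ]; ring
      rwa [e]
  have hsegsub : ∀ a b, b ≤ n → seg a b ⊆ G.edges := by
    intro a b hb x hx
    obtain ⟨j, hj, rfl⟩ := Finset.mem_image.1 hx
    exact he j (by have := (Finset.mem_Ico.1 hj).2; omega)
  have hposmono : ∀ i j, i ≤ j → j ≤ n → 0 ≤ pos j - pos i := by
    intro i j hij hj
    exact ((hseg i j i j le_rfl hij le_rfl).mono (hsegsub i j hj)).nonneg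
  have hlow' : ∀ i j, i ≤ j → j ≤ n → ∀ L, Wk G.edges G.w (f i) (f j) L →
      |pos i - pos j| ≤ L := by
    intro i j hij hj L hL
    have a1 := (hseg 0 n 0 i le_rfl (by omega) (by omega)).mono (hsegsub 0 n le_rfl)
    have a2 := (hseg 0 n j n (by omega) hj le_rfl).mono (hsegsub 0 n le_rfl)
    have a3 := hsh _ ((a1.trans hL).trans a2)
    have a4 : pos 0 = 0 := by simp [pos]
    have a5 : ∑ i ∈ Finset.range n, G.w s(f i, f (i + 1)) = pos n := rfl
    have := hposmono i j hij hj
    rw [abs_sub_comm, abs_of_nonneg this]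
    linarith
  have hlow : ∀ i j, i ≤ n → j ≤ n → ∀ L, Wk G.edges G.w (f i) (f j) L →
      |pos i - pos j| ≤ L := by
    intro i j hi hj L hL
    rcases le_total i j with h | h
    · exact hlow' i j h hj L hL
    · rw [abs_sub_comm]; exact hlow' j i h hi L hL.symm
  have hsegabs : ∀ a b i j, a ≤ i → a ≤ j → i ≤ b → j ≤ b → b ≤ n →
      Wk (seg a b) G.w (f i) (f j) |pos i - pos j| := by
    intro a b i j hai haj hib hjb hb
    rcases le_total i j with h | h
    · rw [abs_sub_comm, abs_of_nonneg (hposmono i j h (by omega))]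
      exact hseg a b i j hai h hjb
    · rw [abs_of_nonneg (hposmono j i h (by omega))]
      exact (hseg a b j i haj h hib).symm
  have htri : ∀ i ∈ S, ∀ j ∈ S, |pos i - pos j| ≤ D i + D j := by
    intro i hi j hj
    exact hlow i j (hSn i hi) (hSn j hj) _ ((hW i hi).symm.trans (hW j hj))
  obtain ⟨T, hTS, hTc, hT⟩ := portals S hS D pos ε h0 h1 (fun i hi => (hW i hi).nonneg)
    (by
      intro i hi j hj
      apply hmin i hi
      rw [abs_sub_comm]
      exact (hW j hj).trans ((hsegabs 0 n j i (by omega) (by omega) (hSn j hj) (hSn i hi)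
        le_rfl).mono (hsegsub 0 n le_rfl))) htri
  have hex : ∀ i ∈ S, ∃ E ⊆ G.edges, setWeight G E ≤ D i ∧ Wk E G.w u (f i) (D i) :=
    fun i hi => (hW i hi).light
  choose! E hEs hEw hEW using hex
  set a := S.min' hS
  set b := S.max' hS
  have ha : a ∈ S := S.min'_mem hS
  have hb : b ∈ S := S.max'_mem hS
  have hab : a ≤ b := S.min'_le b hb
  have hbn := hSn b hb
  refine ⟨seg a b ∪ T.biUnion E, ?_, ?_, ?_⟩
  · exact Finset.union_subset (hsegsub a b hbn)
      (Finset.biUnion_subset.2 fun i hi => hEs i (hTS hi))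
  · have w1 := setWeight_union_le G (seg a b) (T.biUnion E) (hsegsub a b hbn)
    have w2 := setWeight_biUnion_le G T E ℓ (fun i hi => hEs i (hTS hi))
      (fun i hi => (hEw i (hTS hi)).trans (hDl i (hTS hi)))
    have w3 : setWeight G (seg a b) ≤ pos b - pos a := by
      simp only [pos]
      rw [← Finset.sum_Ico_eq_sub _ hab]
      unfold setWeight
      apply Finset.sum_image_le_of_nonneg
      intro i hi
      exact (G.w_pos _ (hsegsub a b hbn hi)).le
    have w4 : pos b - pos a ≤ 2 * ℓ := by
      have := htri b hb a ha
      have := le_abs_self (pos b - pos a)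
      have := hDl a ha
      have := hDl b hb
      linarith
    have hinv : 1 ≤ ε⁻¹ ^ 2 := by
      have : 1 ≤ ε⁻¹ := (one_le_inv₀ h0).2 h1.le
      nlinarith
    nlinarith
  · intro i hi
    obtain ⟨q, hq, hqi⟩ := hT i hi
    refine ⟨_, hqi, ?_⟩
    have hqS := hTS hq
    have c1 : Wk (seg a b ∪ T.biUnion E) G.w u (f q) (D q) :=
      (hEW q hqS).mono ((Finset.subset_biUnion_of_mem E hq).trans Finset.subset_union_right)
    have c2 := (hsegabs a b q i (S.min'_le q hqS) (S.min'_le i hi) (S.le_max' q hqS)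
      (S.le_max' i hi) hbn).mono (Finset.subset_union_left (s₂ := T.biUnion E))
    exact c1.trans c2

/-- Claim 9: a light spanner preserving distances of shortest paths crossing a fixed
shortest path P. -/
theorem crossing_single_path_spanner :
    ∃ C : ℝ, 0 < C ∧
      ∀ (V : Type u) [Fintype V] [DecidableEq V] (G : WGraph V) (ε ℓ : ℝ),
        0 < ε → ε < 1 → 0 < ℓ →
        ∀ (p₁ p₂ : V) (lP : List V), IsShortestPath G p₁ p₂ lP →
        ∀ (r : ℕ) (s t : Fin r → V) (lQ : Fin r → List V),
          (∀ i, IsShortestPath G (s i) (t i) (lQ i)) →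
          (∀ i, walkLen G.w (s i) (lQ i) ≤ ℓ) →
          (∀ i, ∃ v, v ∈ s i :: lQ i ∧ v ∈ p₁ :: lP) →
          ∃ F ⊆ G.edges,
            setWeight G F ≤
              C * ((Finset.image s Finset.univ ∪ Finset.image t Finset.univ).card : ℝ) *
                ε⁻¹ ^ 2 * ℓ ∧
            ∀ i, distIn G F (s i) (t i) ≤ ENNReal.ofReal (1 + ε) * gdist G (s i) (t i) := by
  refine ⟨18, by norm_num, ?_⟩
  intro V _ _ G ε ℓ h0 h1 hl p₁ p₂ lP hP r s t lQ hQ hQl hcr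
  classical
  obtain ⟨n, f, hf0, hfn, he, hsum, hv⟩ := wk_index (w := G.w) hP.1
  let good : V → ℕ → ℝ → Prop := fun u i d =>
    Wk G.edges G.w u (f i) d ∧ d ≤ ℓ ∧ ∀ L, Wk G.edges G.w u (f i) L → d ≤ L
  let S : V → Finset ℕ := fun u => (Finset.range (n + 1)).filter (fun i => ∃ d, good u i d)
  have hS : ∀ u, ∀ i ∈ S u, ∃ d, good u i d := fun u i hi => (Finset.mem_filter.1 hi).2
  choose! D hD using hS
  have key : ∀ u, ∃ F ⊆ G.edges, setWeight G F ≤ 18 * ε⁻¹ ^ 2 * ℓ ∧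
      ∀ i ∈ S u, ∃ L ≤ (1 + ε) * D u i, Wk F G.w u (f i) L := by
    intro u
    apply terminal_spanner G ε ℓ h0 h1 hl n f he _ u (S u)
    · intro i hi
      have := Finset.mem_range.1 (Finset.mem_filter.1 hi).1
      omega
    · exact fun i hi => (hD u i hi).1
    · exact fun i hi => (hD u i hi).2.1
    · exact fun i hi => (hD u i hi).2.2
    · intro L hL
      rw [hf0, hfn] at hL
      rw [hsum]
      exact shortest_le hP hL
  choose F hFs hFw hFW using key
  set K := Finset.image s Finset.univ ∪ Finset.image t Finset.univ with hK
  refine ⟨K.biUnion F, Finset.biUnion_subset.2 fun u _ => hFs u, ?_, ?_⟩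
  · have := setWeight_biUnion_le G K F _ (fun u _ => hFs u) (fun u _ => hFw u)
    linarith
  · intro i
    obtain ⟨v, hvQ, hvP⟩ := hcr i
    obtain ⟨j, hj, rfl⟩ := hv v hvP
    obtain ⟨a, b, hab, ha, hb⟩ := wk_split (w := G.w) (hQ i).1 hvQ
    have hQi := hQl i
    have ha0 := ha.nonneg
    have hb0 := hb.nonneg
    have hga : good (s i) j a := ⟨ha, by linarith, fun L hL => by
      have := shortest_le (hQ i) (hL.trans hb)
      linarith⟩
    have hgb : good (t i) j b := ⟨hb.symm, by linarith, fun L hL => by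
      have := shortest_le (hQ i) (ha.trans hL.symm)
      linarith⟩
    have hjs : j ∈ S (s i) := Finset.mem_filter.2 ⟨Finset.mem_range.2 (by omega), a, hga⟩
    have hjt : j ∈ S (t i) := Finset.mem_filter.2 ⟨Finset.mem_range.2 (by omega), b, hgb⟩
    have hDa : D (s i) j ≤ a := (hD _ _ hjs).2.2 a ha
    have hDb : D (t i) j ≤ b := (hD _ _ hjt).2.2 b hb.symm
    obtain ⟨L1, hL1, hW1⟩ := hFW (s i) j hjs
    obtain ⟨L2, hL2, hW2⟩ := hFW (t i) j hjt
    have hsK : s i ∈ K := by simp [hK]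
    have htK : t i ∈ K := by simp [hK]
    have hW := (hW1.mono (Finset.subset_biUnion_of_mem F hsK)).trans
      (hW2.mono (Finset.subset_biUnion_of_mem F htK)).symm
    obtain ⟨l, hl1, hl2⟩ := hW.toList
    rw [← (hQ i).2.2, ← ENNReal.ofReal_mul (by linarith)]
    refine (iInf₂_le l hl1).trans (ENNReal.ofReal_le_ofReal ?_)
    rw [hl2, ← hab]
    nlinarith
end
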